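/- arXiv:math/0008038 — 2 statements merged into one kernel-verified Lean document; each statement's English description precedes it below -/
import Mathlib

section
/- Fix α ∈ ℂ with 0 < |α| < 1; set r = |1+α|, s = |1−α|, and P(ζ) = −conj(α)·ζ² + (1+|α|²)·ζ − α. Let η : [0,π] → ℂ be continuously differentiable with η(θ)² = P(e^{iθ}) for all θ ∈ [0,π], and define l₁(θ) = (π/r)·η(θ)·(1 − e^{−iθ}) and l₂(θ) = (iπ/s)·η(θ)·(1 + e^{−iθ}). Then ∫₀^π l₁(θ)·l₂′(θ) dθ = (iπ²/(rs))·( −iπ(1+|α|²) + 2(α − conj(α)) ). -/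
open Real

lemma hasDerivAt_cexp_I_mul (θ : ℝ) :
    HasDerivAt (fun t : ℝ => Complex.exp (Complex.I * t))
      (Complex.I * Complex.exp (Complex.I * θ)) θ := by
  have h := ((hasDerivAt_id (θ : ℂ)).const_mul Complex.I).cexp.comp_ofReal
  simpa [mul_comm] using h

lemma hasDerivAt_cexp_neg_I_mul (θ : ℝ) :
    HasDerivAt (fun t : ℝ => Complex.exp (-(Complex.I * t)))
      (-(Complex.I * Complex.exp (-(Complex.I * θ)))) θ := by
  have h := ((hasDerivAt_id (θ : ℂ)).const_mul Complex.I).neg.cexp.comp_ofReal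
  simpa [mul_comm] using h

/-- For the rational spectral curve `η² = P(ζ)`,
`P(ζ) = −ᾱζ² + (1+|α|²)ζ − α` with `0 < |α| < 1`, `r = |1+α|`, `s = |1−α|`, and a
continuously differentiable branch `η` of the square root of `P(e^{iθ})` on `[0,π]`, the
hyperelliptic integral of `l₁ l₂′` with `l₁ = (π/r)·η·(1−e^{−iθ})`,
`l₂ = (iπ/s)·η·(1+e^{−iθ})` equals `(iπ²/(rs))·(−iπ(1+|α|²) + 2(α−ᾱ))`. -/
theorem nonconformal_hyperelliptic_integral
    (α : ℂ) (hα0 : α ≠ 0) (hα1 : ‖α‖ < 1)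
    (r s : ℝ) (hr : r = ‖1 + α‖) (hs : s = ‖1 - α‖)
    (P : ℂ → ℂ)
    (hP : ∀ ζ : ℂ, P ζ = -(starRingEnd ℂ) α * ζ ^ 2
      + (1 + ((‖α‖ : ℂ)) ^ 2) * ζ - α)
    (η : ℝ → ℂ) (hη : ContDiffOn ℝ 1 η (Set.Icc 0 π))
    (hsq : ∀ θ ∈ Set.Icc (0:ℝ) π, η θ ^ 2 = P (Complex.exp (Complex.I * θ)))
    (l₁ l₂ : ℝ → ℂ)
    (hl₁ : ∀ θ : ℝ, l₁ θ = ((π : ℂ) / (r : ℂ)) * η θ * (1 - Complex.exp (-(Complex.I * θ))))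
    (hl₂ : ∀ θ : ℝ, l₂ θ = (Complex.I * (π : ℂ) / (s : ℂ)) * η θ *
      (1 + Complex.exp (-(Complex.I * θ)))) :
    ∫ θ in (0:ℝ)..π, l₁ θ * derivWithin l₂ (Set.Icc 0 π) θ
      = (Complex.I * (π : ℂ) ^ 2 / ((r : ℂ) * (s : ℂ))) *
        (-(Complex.I * (π : ℂ)) * (1 + ((‖α‖ : ℂ)) ^ 2)
          + 2 * (α - (starRingEnd ℂ) α)) := by
  have hint : ∀ θ ∈ Set.uIcc 0 π, l₁ θ * derivWithin l₂ (Set.Icc 0 π) θ =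
      (Complex.I * (π : ℂ) ^ 2 / ((r : ℂ) * (s : ℂ))) * (Complex.I *
        (-(starRingEnd ℂ) α * Complex.exp (Complex.I * θ) ^ 2
          + ((1 + (‖α‖ : ℂ) ^ 2) / 2 + (starRingEnd ℂ) α) * Complex.exp (Complex.I * θ)
          - (1 + (‖α‖ : ℂ) ^ 2)
          + ((1 + (‖α‖ : ℂ) ^ 2) / 2 + α) * Complex.exp (-(Complex.I * θ))
          - α * Complex.exp (-(Complex.I * θ)) ^ 2)) := by
    intro θ hθ
    rw [Set.uIcc_of_le pi_pos.le] at hθ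
    have hu : UniqueDiffWithinAt ℝ (Set.Icc 0 π) θ := uniqueDiffOn_Icc pi_pos θ hθ
    have hηd := (hη.differentiableOn one_ne_zero θ hθ).hasDerivWithinAt
    set d := derivWithin η (Set.Icc 0 π) θ
    have hz := (hasDerivAt_cexp_I_mul θ).hasDerivWithinAt (s := Set.Icc 0 π)
    have hw := (hasDerivAt_cexp_neg_I_mul θ).hasDerivWithinAt (s := Set.Icc 0 π)
    have hPd := (((hz.pow 2).const_mul (-(starRingEnd ℂ) α)).add
      (hz.const_mul (1 + (‖α‖ : ℂ) ^ 2))).sub_const α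
    have hηP := hu.eq_deriv _ ((hηd.pow 2).congr_of_mem
      (fun t ht => ((hsq t ht).trans (hP _)).symm) hθ) hPd
    have hl₂d := ((hηd.const_mul (Complex.I * (π : ℂ) / (s : ℂ))).mul
      (hw.const_add 1)).congr_of_mem (fun t _ => hl₂ t) hθ
    have hsqθ := (hsq θ hθ).trans (hP _)
    have hzw : Complex.exp (Complex.I * θ) * Complex.exp (-(Complex.I * θ)) = 1 := by
      rw [← Complex.exp_add, add_neg_cancel, Complex.exp_zero]
    rw [hl₂d.derivWithin hu, hl₁]
    generalize Complex.exp (Complex.I * θ) = z at *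
    generalize Complex.exp (-(Complex.I * θ)) = w at *
    generalize (starRingEnd ℂ) α = β at *
    generalize (1 + (‖α‖ : ℂ) ^ 2) = c at *
    generalize η θ = e at *
    have hηP' : 2 * e * d = Complex.I * (-2 * β * z ^ 2 + c * z) := by
      norm_num at hηP
      linear_combination hηP
    have key : (1 - w) * e * (d * (1 + w) - e * (Complex.I * w)) = Complex.I *
        (-β * z ^ 2 + (c / 2 + β) * z - c + (c / 2 + α) * w - α * w ^ 2) := by
      linear_combination (1 - w ^ 2) / 2 * hηP' - Complex.I * w * (1 - w) * hsqθ
        + Complex.I * (β * z - c + c / 2 * w) * hzw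
    rw [← key]
    ring
  rw [intervalIntegral.integral_congr hint, intervalIntegral.integral_const_mul]
  congr 1
  have hF : ∀ θ ∈ Set.uIcc 0 π, HasDerivAt (fun t : ℝ =>
      -(starRingEnd ℂ) α / 2 * Complex.exp (Complex.I * t) ^ 2
        + ((1 + (‖α‖ : ℂ) ^ 2) / 2 + (starRingEnd ℂ) α) * Complex.exp (Complex.I * t)
        - Complex.I * (1 + (‖α‖ : ℂ) ^ 2) * t
        - ((1 + (‖α‖ : ℂ) ^ 2) / 2 + α) * Complex.exp (-(Complex.I * t))
        + α / 2 * Complex.exp (-(Complex.I * t)) ^ 2) (Complex.I *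
        (-(starRingEnd ℂ) α * Complex.exp (Complex.I * θ) ^ 2
          + ((1 + (‖α‖ : ℂ) ^ 2) / 2 + (starRingEnd ℂ) α) * Complex.exp (Complex.I * θ)
          - (1 + (‖α‖ : ℂ) ^ 2)
          + ((1 + (‖α‖ : ℂ) ^ 2) / 2 + α) * Complex.exp (-(Complex.I * θ))
          - α * Complex.exp (-(Complex.I * θ)) ^ 2)) θ := by
    intro θ _
    have hz := hasDerivAt_cexp_I_mul θ
    have hw := hasDerivAt_cexp_neg_I_mul θ
    refine HasDerivAt.congr_deriv ((((((hz.pow 2).const_mul (-(starRingEnd ℂ) α / 2)).add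
      (hz.const_mul ((1 + (‖α‖ : ℂ) ^ 2) / 2 + (starRingEnd ℂ) α))).sub
      ((hasDerivAt_id (θ : ℂ)).comp_ofReal.const_mul (Complex.I * (1 + (‖α‖ : ℂ) ^ 2)))).sub
      (hw.const_mul ((1 + (‖α‖ : ℂ) ^ 2) / 2 + α))).add
      ((hw.pow 2).const_mul (α / 2))) ?_
    norm_num
    ring
  rw [intervalIntegral.integral_eq_sub_of_hasDerivAt hF
    (Continuous.intervalIntegrable (by fun_prop) _ _)]
  have hπ : Complex.exp (Complex.I * π) = -1 := by rw [mul_comm, Complex.exp_pi_mul_I]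
  rw [Complex.exp_neg, hπ]
  norm_num
  ring
end

section
/- Fix α ∈ ℂ with 0 < |α| < 1; set r = |1+α|, s = |1−α|, and P(ζ) = −conj(α)·ζ² + (1+|α|²)·ζ − α. Let U ⊆ ℂ be an open neighborhood of 0 and η : U → ℂ holomorphic with η(ζ)² = P(ζ) for all ζ ∈ U. For ζ ∈ U∖{0} let f₁(ζ) be the complex derivative of ζ ↦ (π/r)·η(ζ)·(1 − 1/ζ) and f₂(ζ) the complex derivative of ζ ↦ (iπ/s)·η(ζ)·(1 + 1/ζ). Then ζ³·( f₁(ζ)·f₂′(ζ) − f₂(ζ)·f₁′(ζ) ) tends to 2iπ²(1+|α|²)/(rs) as ζ → 0 (ζ ≠ 0). -/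
open Real

open Topology in
/-- The Wronskian of the derivatives of `c₁ (1 - 1/z) η` and `c₂ (1 + 1/z) η`, for `η` holomorphic
near `0`, has principal coefficient `4 c₁ c₂ η(0) η'(0)` at its triple pole. -/
theorem tendsto_cube_mul_wronskian {U : Set ℂ} (hU : IsOpen U) (h0 : (0 : ℂ) ∈ U)
    {η : ℂ → ℂ} (hη : DifferentiableOn ℂ η U) (c₁ c₂ : ℂ) {f₁ f₂ : ℂ → ℂ}
    (hf₁ : ∀ ζ ∈ U \ {0}, f₁ ζ = deriv (fun z : ℂ => c₁ * η z * (1 - 1 / z)) ζ)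
    (hf₂ : ∀ ζ ∈ U \ {0}, f₂ ζ = deriv (fun z : ℂ => c₂ * η z * (1 + 1 / z)) ζ) :
    Filter.Tendsto (fun ζ : ℂ => ζ ^ 3 * (f₁ ζ * deriv f₂ ζ - f₂ ζ * deriv f₁ ζ))
      (𝓝[≠] 0) (𝓝 (4 * c₁ * c₂ * (η 0 * deriv η 0))) := by
  have hη' : DifferentiableOn ℂ (deriv η) U := hη.deriv hU
  have hη'' : DifferentiableOn ℂ (deriv (deriv η)) U := hη'.deriv hU
  have hasDeriv {g : ℂ → ℂ} (hg : DifferentiableOn ℂ g U) {z : ℂ} (hz : z ∈ U) :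
      HasDerivAt g (deriv g z) z := (hg.differentiableAt (hU.mem_nhds hz)).hasDerivAt
  have hV : IsOpen (U \ {0}) := hU.sdiff isClosed_singleton
  have first (c e : ℂ) {z : ℂ} (hz : z ∈ U \ {0}) :
      HasDerivAt (fun z => c * η z * (1 + e * z⁻¹))
        (c * (deriv η z * (1 + e * z⁻¹) - e * η z * z⁻¹ ^ 2)) z := by
    have hz0 : z ≠ 0 := hz.2
    refine (((hasDeriv hη hz.1).const_mul c).mul
      (((hasDerivAt_inv hz0).const_mul e).const_add 1)).congr_deriv ?_
    field_simp
    ring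
  have second (c e : ℂ) {z : ℂ} (hz : z ∈ U \ {0}) :
      HasDerivAt (fun z => c * (deriv η z * (1 + e * z⁻¹) - e * η z * z⁻¹ ^ 2))
        (c * (deriv (deriv η) z * (1 + e * z⁻¹) - 2 * e * deriv η z * z⁻¹ ^ 2
          + 2 * e * η z * z⁻¹ ^ 3)) z := by
    have hz0 : z ≠ 0 := hz.2
    refine ((((hasDeriv hη' hz.1).mul
      (((hasDerivAt_inv hz0).const_mul e).const_add 1)).sub
      (((hasDeriv hη hz.1).const_mul e).mul
        ((hasDerivAt_inv hz0).pow 2))).const_mul c).congr_deriv ?_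
    simp only [Pi.pow_apply, Nat.reduceSub, pow_one, Nat.cast_ofNat]
    field_simp
    ring
  have value (c e : ℂ) {f : ℂ → ℂ}
      (hf : ∀ ζ ∈ U \ {0}, f ζ = deriv (fun z : ℂ => c * η z * (1 + e * z⁻¹)) ζ) :
      ∀ z ∈ U \ {0}, f z = c * (deriv η z * (1 + e * z⁻¹) - e * η z * z⁻¹ ^ 2) :=
    fun z hz => (hf z hz).trans (first c e hz).deriv
  have value' (c e : ℂ) {f : ℂ → ℂ}
      (hf : ∀ ζ ∈ U \ {0}, f ζ = deriv (fun z : ℂ => c * η z * (1 + e * z⁻¹)) ζ) :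
      ∀ z ∈ U \ {0}, deriv f z = c * (deriv (deriv η) z * (1 + e * z⁻¹)
        - 2 * e * deriv η z * z⁻¹ ^ 2 + 2 * e * η z * z⁻¹ ^ 3) := fun z hz =>
    ((second c e hz).congr_of_eventuallyEq
      (Filter.eventuallyEq_of_mem (hV.mem_nhds hz) (value c e hf))).deriv
  replace hf₁ : ∀ ζ ∈ U \ {0}, f₁ ζ = deriv (fun z : ℂ => c₁ * η z * (1 + -1 * z⁻¹)) ζ := by
    simpa [sub_eq_add_neg] using hf₁
  replace hf₂ : ∀ ζ ∈ U \ {0}, f₂ ζ = deriv (fun z : ℂ => c₂ * η z * (1 + 1 * z⁻¹)) ζ := by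
    simpa using hf₂
  have hmem : U \ {0} ∈ 𝓝[≠] (0 : ℂ) := Filter.inter_mem
    (mem_nhdsWithin_of_mem_nhds (hU.mem_nhds h0)) self_mem_nhdsWithin
  have hlim : ContinuousAt (fun z : ℂ => 2 * c₁ * c₂ *
      (deriv η z * (z ^ 2 * deriv (deriv η) z - 2 * z * deriv η z + 2 * η z)
        - (z ^ 2 * deriv η z - z * η z) * deriv (deriv η) z)) 0 := by
    have k₀ := (hasDeriv hη h0).continuousAt
    have k₁ := (hasDeriv hη' h0).continuousAt
    have k₂ := (hasDeriv hη'' h0).continuousAt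
    fun_prop
  have hlim' := hlim.tendsto.mono_left (nhdsWithin_le_nhds (s := {0}ᶜ))
  refine (hlim'.congr' (Filter.eventuallyEq_of_mem hmem fun z hz => ?_)).trans
    (le_of_eq (congrArg 𝓝 (by ring)))
  have hz0 : z ≠ 0 := hz.2
  simp only [value c₁ (-1) hf₁ z hz, value c₂ 1 hf₂ z hz, value' c₁ (-1) hf₁ z hz,
    value' c₂ 1 hf₂ z hz]
  field_simp
  ring

/-- For the rational spectral curve `η² = P(ζ)`,
`P(ζ) = −ᾱζ² + (1+|α|²)ζ − α` with `0 < |α| < 1`, `r = |1+α|`, `s = |1−α|`, a holomorphic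
branch `η` of `√P` on an open neighbourhood `U` of `0`, and
`f₁ = ((π/r)·η·(1−1/ζ))′`, `f₂ = ((iπ/s)·η·(1+1/ζ))′` (complex derivatives), the Wronskian
`f₁f₂′ − f₂f₁′` has a triple pole at `ζ = 0`:
`ζ³·(f₁f₂′ − f₂f₁′) → 2iπ²(1+|α|²)/(rs)` as `ζ → 0`, `ζ ≠ 0`. -/
theorem nonconformal_wronskian_principal_part
    (α : ℂ) (hα0 : α ≠ 0) (hα1 : ‖α‖ < 1)
    (r s : ℝ) (hr : r = ‖1 + α‖) (hs : s = ‖1 - α‖)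
    (P : ℂ → ℂ)
    (hP : ∀ ζ : ℂ, P ζ = -(starRingEnd ℂ) α * ζ ^ 2
      + (1 + ((‖α‖ : ℂ)) ^ 2) * ζ - α)
    (U : Set ℂ) (hU : IsOpen U) (h0 : (0 : ℂ) ∈ U)
    (η : ℂ → ℂ) (hη : DifferentiableOn ℂ η U)
    (hsq : ∀ ζ ∈ U, η ζ ^ 2 = P ζ)
    (f₁ f₂ : ℂ → ℂ)
    (hf₁ : ∀ ζ ∈ U \ {0},
      f₁ ζ = deriv (fun z : ℂ => ((π : ℂ) / (r : ℂ)) * η z * (1 - 1 / z)) ζ)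
    (hf₂ : ∀ ζ ∈ U \ {0},
      f₂ ζ = deriv (fun z : ℂ => (Complex.I * (π : ℂ) / (s : ℂ)) * η z * (1 + 1 / z)) ζ) :
    Filter.Tendsto
      (fun ζ : ℂ => ζ ^ 3 * (f₁ ζ * deriv f₂ ζ - f₂ ζ * deriv f₁ ζ))
      (nhdsWithin 0 {(0 : ℂ)}ᶜ)
      (nhds (2 * Complex.I * (π : ℂ) ^ 2 * (1 + ((‖α‖ : ℂ)) ^ 2)
        / ((r : ℂ) * (s : ℂ)))) := by
  have hη0 : HasDerivAt η (deriv η 0) 0 :=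
    (hη.differentiableAt (hU.mem_nhds h0)).hasDerivAt
  have hP0 : HasDerivAt P (1 + (‖α‖ : ℂ) ^ 2) 0 := by
    rw [funext hP]
    refine (((((hasDerivAt_id (0 : ℂ)).pow 2).const_mul (-(starRingEnd ℂ) α)).add
      ((hasDerivAt_id (0 : ℂ)).const_mul (1 + (‖α‖ : ℂ) ^ 2))).sub_const α).congr_deriv ?_
    simp
  have key : 2 * (η 0 * deriv η 0) = 1 + (‖α‖ : ℂ) ^ 2 := by
    have h := (hη0.pow 2).unique
      (hP0.congr_of_eventuallyEq (Filter.eventuallyEq_of_mem (hU.mem_nhds h0) hsq))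
    rw [← h]
    push_cast
    ring
  convert tendsto_cube_mul_wronskian hU h0 hη _ _ hf₁ hf₂ using 2
  rw [← key]
  ring
end
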